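/- Let n ≥ 1 and let m = 2n or m = 2n+1. For every integer t with 0 ≤ t ≤ m and every y ∈ F₂^m, writing j = wt(y), one has (1/2^n) · ∑_{x ∈ F₂^m, wt(x) = t} Γ_x Γ_y Γ_x = W_t(j) · Γ_y, where W_t(j) = ((−1)^{t·j}/2^n) · ∑_{s=0}^{t} (−1)^s · C(j, s) · C(m − j, t − s) and C denotes the binomial coefficient. In particular, each span V_j^{Cl(m)} = span{Γ_y : wt(y) = j} is an eigenspace of the superoperator Φ_t(X) = (1/2^n) ∑_{wt(x)=t} Γ_x X Γ_x with eigenvalue W_t(j). -/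

import Mathlib

noncomputable section

open Matrix

/-- The Pauli matrix `σ_x`. -/
def pauliX : Matrix (Fin 2) (Fin 2) ℂ := !![0, 1; 1, 0]

/-- The Pauli matrix `σ_y`. -/
def pauliY : Matrix (Fin 2) (Fin 2) ℂ := !![0, -Complex.I; Complex.I, 0]

/-- The Pauli matrix `σ_z`. -/
def pauliZ : Matrix (Fin 2) (Fin 2) ℂ := !![1, 0; 0, -1]

/-- The single-site factor of the `k`-th Weyl–Brauer matrix (with `k` 1-based and
site `i` 0-based): for `1 ≤ k ≤ n` it is `σ_z` on sites before site `k`, `σ_x` at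
site `k`, and the identity afterwards; for `n+1 ≤ k ≤ 2n` the same with `σ_y` at site
`k - n`; and for `k = 2n+1` it is `σ_z` everywhere. -/
def wbFactor (n k i : ℕ) : Matrix (Fin 2) (Fin 2) ℂ :=
  if k ≤ n then (if i + 1 < k then pauliZ else if i + 1 = k then pauliX else 1)
  else if k ≤ 2 * n then
    (if i + 1 < k - n then pauliZ else if i + 1 = k - n then pauliY else 1)
  else pauliZ

/-- The `k`-th Weyl–Brauer matrix on `(ℂ²)^{⊗n}` (with `k` 1-based, `1 ≤ k ≤ 2n+1`),
realized as a matrix indexed by `Fin n → Fin 2`: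
`U_k = σ_z^{⊗(k−1)} ⊗ σ_x ⊗ I₂^{⊗(n−k)}`, `U_{n+k} = σ_z^{⊗(k−1)} ⊗ σ_y ⊗ I₂^{⊗(n−k)}`
for `1 ≤ k ≤ n`, and `U_{2n+1} = σ_z^{⊗n}`. -/
def weylBrauer (n k : ℕ) : Matrix (Fin n → Fin 2) (Fin n → Fin 2) ℂ :=
  Matrix.of fun a b => ∏ i : Fin n, wbFactor n k (i : ℕ) (a i) (b i)

/-- The Hamming weight of a binary vector: the number of nonzero components. -/
def wtZ {l : ℕ} (x : Fin l → ZMod 2) : ℕ :=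
  (Finset.filter (fun i => x i ≠ 0) Finset.univ).card

/-- `τ(x) = wt(x)(wt(x) − 1)/2`. -/
def tauZ {l : ℕ} (x : Fin l → ZMod 2) : ℕ := wtZ x * (wtZ x - 1) / 2

/-- The `k`-th (0-based) component of `x` as a natural number (`0` or `1`), with the
convention that it is `0` out of range. -/
def xcomp {l : ℕ} (x : Fin l → ZMod 2) (k : ℕ) : ℕ :=
  if h : k < l then (x ⟨k, h⟩).val else 0

/-- The Clifford operator `Γ_x` on `(ℂ²)^{⊗n}` for `x ∈ F₂^l`, intended for `l = 2n`
(even case) or `l = 2n+1` (odd case):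
`Γ_x = i^{τ(x)} (∏_{k=1}^{n} U_k^{x_k} U_{n+k}^{x_{n+k}}) U_{2n+1}^{x_{2n+1}}`,
the product taken over `k` in increasing order, where the final factor
`U_{2n+1}^{x_{2n+1}}` is `1` when `l = 2n`. -/
def gammaOp (n l : ℕ) (x : Fin l → ZMod 2) : Matrix (Fin n → Fin 2) (Fin n → Fin 2) ℂ :=
  (Complex.I ^ tauZ x) •
    ((((List.finRange n).map fun k =>
        weylBrauer n ((k : ℕ) + 1) ^ xcomp x (k : ℕ) *
          weylBrauer n (n + (k : ℕ) + 1) ^ xcomp x (n + (k : ℕ))).prod) *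
      weylBrauer n (2 * n + 1) ^ xcomp x (2 * n))

/-- The `W_t(j)` coefficients of the `Cl(m)` quantum metric:
`W_t(j) = ((−1)^{t·j}/2^n) ∑_{s=0}^{t} (−1)^s C(j,s) C(m−j, t−s)`. -/
def Wcl (n m t j : ℕ) : ℂ :=
  ((-1 : ℂ) ^ (t * j) / 2 ^ n) *
    ∑ s ∈ Finset.range (t + 1),
      (-1 : ℂ) ^ s * (j.choose s : ℂ) * ((m - j).choose (t - s) : ℂ)

lemma pX2 : pauliX * pauliX = 1 := by
  ext i j; fin_cases i <;> fin_cases j <;> simp [pauliX, Matrix.mul_apply]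
lemma pY2 : pauliY * pauliY = 1 := by
  ext i j; fin_cases i <;> fin_cases j <;> simp [pauliY, Matrix.mul_apply]
lemma pZ2 : pauliZ * pauliZ = 1 := by
  ext i j; fin_cases i <;> fin_cases j <;> simp [pauliZ, Matrix.mul_apply]
lemma pXY : pauliX * pauliY = -(pauliY * pauliX) := by
  ext i j; fin_cases i <;> fin_cases j <;> simp [pauliX, pauliY, Matrix.mul_apply]
lemma pXZ : pauliX * pauliZ = -(pauliZ * pauliX) := by
  ext i j; fin_cases i <;> fin_cases j <;> simp [pauliX, pauliZ, Matrix.mul_apply]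
lemma pYZ : pauliY * pauliZ = -(pauliZ * pauliY) := by
  ext i j; fin_cases i <;> fin_cases j <;> simp [pauliY, pauliZ, Matrix.mul_apply]

/-- position of the non-Z, non-identity site. -/
def wbPos (n k : ℕ) : ℕ := if k ≤ n then k else if k ≤ 2 * n then k - n else n + 1

lemma wbFactor_sq (n k i : ℕ) : wbFactor n k i * wbFactor n k i = 1 := by
  unfold wbFactor
  split_ifs <;> simp [pX2, pY2, pZ2]

lemma wbFactor_comm (n j k i : ℕ) (hjk : j ≠ k) (hi : i < n) (hj : 1 ≤ j) (hk : 1 ≤ k)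
    (hj' : j ≤ 2 * n + 1) (hk' : k ≤ 2 * n + 1) :
    wbFactor n j i * wbFactor n k i =
      (if i + 1 = min (wbPos n j) (wbPos n k) then (-1 : ℂ) else 1) •
        (wbFactor n k i * wbFactor n j i) := by
  unfold wbFactor wbPos
  split_ifs <;> first | omega | simp [pXY, pXZ, pYZ]

lemma wb_mul (n j k : ℕ) : weylBrauer n j * weylBrauer n k =
    Matrix.of fun a c => ∏ i : Fin n, (wbFactor n j i * wbFactor n k i) (a i) (c i) := by
  ext a c
  simp only [weylBrauer, Matrix.mul_apply, Matrix.of_apply]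
  rw [Finset.prod_univ_sum, Fintype.piFinset_univ]
  simp only [Finset.prod_mul_distrib]

lemma wb_sq (n k : ℕ) : weylBrauer n k * weylBrauer n k = 1 := by
  rw [wb_mul]
  ext a c
  simp only [wbFactor_sq, Matrix.of_apply, Matrix.one_apply]
  by_cases h : a = c
  · simp [h]
  · rw [if_neg h]
    obtain ⟨i, hi⟩ := Function.ne_iff.mp h
    exact Finset.prod_eq_zero (Finset.mem_univ i) (by simp [hi])

lemma wb_anti (n j k : ℕ) (hjk : j ≠ k) (hj : 1 ≤ j) (hk : 1 ≤ k)
    (hj' : j ≤ 2 * n + 1) (hk' : k ≤ 2 * n + 1) :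
    weylBrauer n j * weylBrauer n k = (-1 : ℂ) • (weylBrauer n k * weylBrauer n j) := by
  rw [wb_mul, wb_mul]
  ext a c
  simp only [Matrix.of_apply, Matrix.smul_apply, smul_eq_mul]
  have h1 : 1 ≤ min (wbPos n j) (wbPos n k) ∧ min (wbPos n j) (wbPos n k) ≤ n := by
    unfold wbPos
    split_ifs <;> omega
  have h2 : (∏ i : Fin n,
      (if (i : ℕ) + 1 = min (wbPos n j) (wbPos n k) then (-1 : ℂ) else 1)) = -1 := by
    rw [Finset.prod_eq_single (⟨min (wbPos n j) (wbPos n k) - 1, by omega⟩ : Fin n)]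
    · rw [if_pos]
      simp only
      omega
    · intro b _ hb
      rw [if_neg]
      intro h
      apply hb
      ext
      simp only
      omega
    · simp
  rw [← h2, ← Finset.prod_mul_distrib]
  apply Finset.prod_congr rfl
  intro i _
  rw [wbFactor_comm n j k i hjk i.2 hj hk hj' hk']
  simp

section Abs
variable {A : Type*} [Ring A] [Algebra ℂ A]

/-- sign of exchange -/
def epsS (j k : ℕ) : ℂ := if j = k then 1 else -1

lemma pow_exch (u v : A) (e : ℂ) (h : u * v = e • (v * u)) (a b : ℕ) :
    u ^ a * v ^ b = e ^ (a * b) • (v ^ b * u ^ a) := by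
  have h1 : ∀ b, u * v ^ b = e ^ b • (v ^ b * u) := by
    intro b
    induction b with
    | zero => simp
    | succ b ih =>
      rw [pow_succ, ← mul_assoc, ih, smul_mul_assoc, mul_assoc, h, mul_smul_comm, smul_smul,
        ← mul_assoc, pow_succ]
  induction a with
  | zero => simp
  | succ a ih =>
    rw [pow_succ', mul_assoc, ih, mul_smul_comm, ← mul_assoc, h1, smul_mul_assoc, smul_smul,
      mul_assoc, ← pow_add]
    congr 2
    ring

lemma exch_list (U : ℕ → A) (N : ℕ)
    (hU : ∀ j < N, ∀ k < N, U j * U k = epsS j k • (U k * U j)) (a b : ℕ → ℕ)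
    (j : ℕ) (hj : j < N) (M : List ℕ) (hM : ∀ k ∈ M, k < N) :
    U j ^ a j * (M.map fun k => U k ^ b k).prod =
      (M.map fun k => epsS j k ^ (a j * b k)).prod •
        ((M.map fun k => U k ^ b k).prod * U j ^ a j) := by
  induction M with
  | nil => simp
  | cons k M ih =>
    simp only [List.map_cons, List.prod_cons]
    rw [← mul_assoc, pow_exch _ _ _ (hU j hj k (hM k (by simp))), smul_mul_assoc, mul_assoc,
      ih (fun l hl => hM l (by simp [hl])), mul_smul_comm, smul_smul, mul_assoc]

lemma exch_list2 (U : ℕ → A) (N : ℕ)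
    (hU : ∀ j < N, ∀ k < N, U j * U k = epsS j k • (U k * U j)) (a b : ℕ → ℕ)
    (L M : List ℕ) (hL : ∀ k ∈ L, k < N) (hM : ∀ k ∈ M, k < N) :
    (L.map fun k => U k ^ a k).prod * (M.map fun k => U k ^ b k).prod =
      (L.map fun j => (M.map fun k => epsS j k ^ (a j * b k)).prod).prod •
        ((M.map fun k => U k ^ b k).prod * (L.map fun k => U k ^ a k).prod) := by
  induction L with
  | nil => simp
  | cons j L ih =>
    simp only [List.map_cons, List.prod_cons]
    rw [mul_assoc, ih (fun l hl => hL l (by simp [hl])), mul_smul_comm, ← mul_assoc,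
      exch_list U N hU a b j (hL j (by simp)) M hM, smul_mul_assoc, smul_smul, mul_assoc, mul_comm]

lemma sq_list (U : ℕ → A) (N : ℕ)
    (hU : ∀ j < N, ∀ k < N, U j * U k = epsS j k • (U k * U j))
    (hU2 : ∀ j < N, U j * U j = 1) (a : ℕ → ℕ) (ha : ∀ k, a k ≤ 1)
    (L : List ℕ) (hL : ∀ k ∈ L, k < N) (hnd : L.Nodup) :
    (L.map fun k => U k ^ a k).prod * (L.map fun k => U k ^ a k).prod =
      ((-1 : ℂ) ^ ((L.map a).sum.choose 2)) • (1 : A) := by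
  induction L with
  | nil => simp
  | cons j L ih =>
    have hL' : ∀ k ∈ L, k < N := fun l hl => hL l (by simp [hl])
    rw [List.nodup_cons] at hnd
    have hs : (L.map fun k => epsS j k ^ (a j * a k)).prod = (-1) ^ (a j * (L.map a).sum) := by
      have : ∀ M : List ℕ, j ∉ M →
          (M.map fun k => epsS j k ^ (a j * a k)).prod = (-1) ^ (a j * (M.map a).sum) := by
        intro M
        induction M with
        | nil => simp
        | cons k M ihM =>
          intro h
          simp only [List.mem_cons, not_or] at h
          simp only [List.map_cons, List.prod_cons, List.sum_cons]
          rw [ihM h.2, epsS, if_neg h.1, ← pow_add, mul_add]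
      exact this L hnd.1
    have he := exch_list U N hU a a j (hL j (by simp)) L hL'
    rw [hs] at he
    specialize ih hL' hnd.2
    simp only [List.map_cons, List.prod_cons, List.sum_cons]
    set P := (L.map fun k => U k ^ a k).prod
    set w := (L.map a).sum
    have hsq : U j ^ a j * U j ^ a j = 1 := by
      rcases Nat.le_one_iff_eq_zero_or_eq_one.mp (ha j) with h | h <;>
        simp [h, hU2 j (hL j (by simp))]
    have : U j ^ a j * P * (U j ^ a j * P) = (-1 : ℂ) ^ (a j * w) • (P * P) := by
      calc _ = (U j ^ a j * P) * U j ^ a j * P := by simp only [mul_assoc]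
        _ = _ := by
          rw [he, smul_mul_assoc, smul_mul_assoc, mul_assoc P, hsq, mul_one]
    rw [this, ih, smul_smul, ← pow_add]
    congr 2
    rcases Nat.le_one_iff_eq_zero_or_eq_one.mp (ha j) with h | h
    · simp [h]
    · rw [h, add_comm 1 w, Nat.choose_succ_succ' w 1]; simp
end Abs

/-- the order of the generators -/
def genL (n : ℕ) : List ℕ := ((List.finRange n).flatMap fun k : Fin n => [(k : ℕ), n + (k : ℕ)]) ++ [2 * n]

lemma genL_mem (n k : ℕ) : k ∈ genL n ↔ k < 2 * n + 1 := by
  simp only [genL, List.mem_append, List.mem_flatMap, List.mem_finRange, true_and, List.mem_cons,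
    List.not_mem_nil, or_false]
  constructor
  · rintro (⟨a, h | h⟩ | h) <;> omega
  · intro h
    by_cases h1 : k < n
    · exact Or.inl ⟨⟨k, h1⟩, Or.inl rfl⟩
    by_cases h2 : k < 2 * n
    · exact Or.inl ⟨⟨k - n, by omega⟩, Or.inr (by simp; omega)⟩
    · right; omega

lemma genL_nodup (n : ℕ) : (genL n).Nodup := by
  have hlen : (genL n).length = 2 * n + 1 := by
    simp [genL, List.length_flatMap, mul_comm]
  have : (genL n).toFinset = Finset.range (2 * n + 1) := by
    ext k; simp [genL_mem]
  have hc : (genL n).toFinset.card = (genL n).length := by rw [this, hlen]; simp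
  exact Multiset.toFinset_card_eq_card_iff_nodup.mp hc

lemma genL_prod (n : ℕ) (f : ℕ → ℂ) :
    ((genL n).map f).prod = ∏ k ∈ Finset.range (2 * n + 1), f k := by
  have : (genL n).toFinset = Finset.range (2 * n + 1) := by
    ext k; simp [genL_mem]
  rw [← this, List.prod_toFinset f (genL_nodup n)]

lemma genL_sum (n : ℕ) (f : ℕ → ℕ) :
    ((genL n).map f).sum = ∑ k ∈ Finset.range (2 * n + 1), f k := by
  have : (genL n).toFinset = Finset.range (2 * n + 1) := by
    ext k; simp [genL_mem]
  rw [← this, List.sum_toFinset f (genL_nodup n)]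

lemma gamma_eq (n m : ℕ) (x : Fin m → ZMod 2) : gammaOp n m x =
    (Complex.I ^ tauZ x) • ((genL n).map fun k => weylBrauer n (k + 1) ^ xcomp x k).prod := by
  unfold gammaOp genL
  congr 1
  rw [List.map_append, List.prod_append]
  congr 1
  · induction List.finRange n with
    | nil => simp
    | cons k l ih =>
      simp only [List.bind_eq_flatMap, List.pure_def] at ih ⊢
      simp [ih, mul_assoc]
  · simp

lemma xcomp_le {m : ℕ} (x : Fin m → ZMod 2) (k : ℕ) : xcomp x k ≤ 1 := by
  unfold xcomp
  split_ifs with h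
  · have := ZMod.val_lt (x ⟨k, h⟩); omega
  · simp

lemma xcomp_fin {m : ℕ} (x : Fin m → ZMod 2) (i : Fin m) :
    xcomp x i = if x i ≠ 0 then 1 else 0 := by
  simp only [xcomp, i.2, dif_pos, Fin.eta]
  generalize x i = v
  revert v; decide

lemma sum_xcomp {m N : ℕ} (h : m ≤ N) (x : Fin m → ZMod 2) :
    ∑ k ∈ Finset.range N, xcomp x k = wtZ x := by
  rw [← Finset.sum_subset (Finset.range_subset_range.mpr h)
    (fun k _ hk => by simp only [Finset.mem_range] at hk; simp [xcomp, hk]),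
    Finset.sum_range, wtZ, Finset.card_filter]
  exact Finset.sum_congr rfl fun i _ => xcomp_fin x i

lemma U_exch (n : ℕ) : ∀ j < 2 * n + 1, ∀ k < 2 * n + 1,
    weylBrauer n (j + 1) * weylBrauer n (k + 1) =
      epsS j k • (weylBrauer n (k + 1) * weylBrauer n (j + 1)) := by
  intro j hj k hk
  unfold epsS
  split_ifs with h
  · simp [h]
  · exact wb_anti n _ _ (by omega) (by omega) (by omega) (by omega) (by omega)

lemma gamma_sq (n m : ℕ) (hm : m ≤ 2 * n + 1) (x : Fin m → ZMod 2) :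
    gammaOp n m x * gammaOp n m x = 1 := by
  rw [gamma_eq, smul_mul_assoc, mul_smul_comm, sq_list (fun k => weylBrauer n (k + 1)) (2 * n + 1)
    (U_exch n) (fun j _ => wb_sq n _) _ (xcomp_le x) _ (fun k hk => (genL_mem n k).mp hk)
    (genL_nodup n), genL_sum, sum_xcomp hm, smul_smul, smul_smul, Nat.choose_two_right, tauZ,
    ← mul_pow, ← mul_pow]
  simp

/-- the character sign -/
def chi {m : ℕ} (x y : Fin m → ZMod 2) : ℂ :=
  ∏ i, if x i ≠ 0 then (-1 : ℂ) ^ xcomp y i else 1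

lemma sign_eq (n m : ℕ) (hm : m ≤ 2 * n + 1) (x y : Fin m → ZMod 2) :
    ((genL n).map fun j => ((genL n).map fun k => epsS j k ^ (xcomp x j * xcomp y k)).prod).prod
      = (-1) ^ (wtZ x * wtZ y) * chi x y := by
  simp only [genL_prod]
  have h1 : ∀ j ∈ Finset.range (2 * n + 1),
      ∏ k ∈ Finset.range (2 * n + 1), epsS j k ^ (xcomp x j * xcomp y k) =
      (-1) ^ (xcomp x j * wtZ y) * (-1) ^ (xcomp x j * xcomp y j) := by
    intro j hj
    have h2 : ∀ k, epsS j k ^ (xcomp x j * xcomp y k) =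
        (-1) ^ (xcomp x j * xcomp y k) *
          (if j = k then (-1) ^ (xcomp x j * xcomp y k) else 1) := by
      intro k
      unfold epsS
      split_ifs
      · rw [← mul_pow]; simp
      · simp
    simp only [h2]
    rw [Finset.prod_mul_distrib, Finset.prod_ite_eq, if_pos hj, Finset.prod_pow_eq_pow_sum,
      ← Finset.mul_sum, sum_xcomp hm]
  rw [Finset.prod_congr rfl h1, Finset.prod_mul_distrib, Finset.prod_pow_eq_pow_sum,
    ← Finset.sum_mul, sum_xcomp hm]
  congr 1
  rw [← Finset.prod_subset (Finset.range_subset_range.mpr hm)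
    (fun k _ hk => by simp only [Finset.mem_range] at hk; simp [xcomp, hk]),
    Finset.prod_range, chi]
  refine Finset.prod_congr rfl fun i _ => ?_
  rw [xcomp_fin x i]
  split_ifs <;> simp

lemma gamma_conj (n m : ℕ) (hm : m ≤ 2 * n + 1) (x y : Fin m → ZMod 2) :
    gammaOp n m x * gammaOp n m y * gammaOp n m x =
      ((-1) ^ (wtZ x * wtZ y) * chi x y) • gammaOp n m y := by
  have h : gammaOp n m x * gammaOp n m y =
      ((-1) ^ (wtZ x * wtZ y) * chi x y) • (gammaOp n m y * gammaOp n m x) := by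
    rw [gamma_eq n m x, gamma_eq n m y, smul_mul_assoc, mul_smul_comm,
      exch_list2 (fun k => weylBrauer n (k + 1)) (2 * n + 1) (U_exch n) _ _ _ _
      (fun k hk => (genL_mem n k).mp hk) (fun k hk => (genL_mem n k).mp hk), sign_eq n m hm,
      smul_mul_assoc, mul_smul_comm]
    simp only [smul_smul]
    congr 1
    ring
  rw [h, smul_mul_assoc, mul_assoc, gamma_sq n m hm, mul_one]

open Polynomial in
lemma kraw (m t : ℕ) (y : Fin m → ZMod 2) :
    ∑ x ∈ Finset.filter (fun x : Fin m → ZMod 2 => wtZ x = t) Finset.univ, chi x y =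
    ∑ s ∈ Finset.range (t + 1),
      (-1 : ℂ) ^ s * ((wtZ y).choose s : ℂ) * ((m - wtZ y).choose (t - s) : ℂ) := by
  have key : ∑ x : Fin m → ZMod 2, (C (chi x y) * X ^ wtZ x : ℂ[X]) =
      (1 - X) ^ wtZ y * (1 + X) ^ (m - wtZ y) := by
    have h1 : ∀ x : Fin m → ZMod 2, (C (chi x y) * X ^ wtZ x : ℂ[X]) =
        ∏ i, (if x i ≠ 0 then C ((-1 : ℂ) ^ xcomp y i) * X else 1) := by
      intro x
      rw [chi, map_prod, wtZ, Finset.prod_ite, Finset.prod_mul_distrib, Finset.prod_const_one,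
        mul_one, Finset.prod_const]
      congr 1
      simp only [apply_ite C, map_one]
      rw [Finset.prod_ite, Finset.prod_const_one, mul_one]
    simp only [h1]
    have h2 := Finset.prod_univ_sum (fun _ : Fin m => (Finset.univ : Finset (ZMod 2)))
      (fun i v => (if v ≠ 0 then C ((-1 : ℂ) ^ xcomp y i) * X else 1 : ℂ[X]))
    rw [Fintype.piFinset_univ] at h2
    rw [← h2]
    have h3 : ∀ i : Fin m, ∑ v : ZMod 2, (if v ≠ 0 then C ((-1 : ℂ) ^ xcomp y i) * X else 1 : ℂ[X])
        = if y i ≠ 0 then 1 - X else 1 + X := by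
      intro i
      rw [xcomp_fin]
      have : ∀ f : ZMod 2 → ℂ[X], ∑ v, f v = f 0 + f 1 := fun f => Fin.sum_univ_two f
      rw [this]
      split_ifs <;> simp_all [sub_eq_add_neg]
    simp only [h3]
    rw [Finset.prod_ite, Finset.prod_const, Finset.prod_const]
    congr 2
    have := Finset.card_filter_add_card_filter_not (s := (Finset.univ : Finset (Fin m)))
      (fun i => y i ≠ 0)
    simp only [Finset.card_univ, Fintype.card_fin] at this
    unfold wtZ
    omega
  have hc := congrArg (fun p => coeff p t) key
  simp only [finsetSum_coeff, coeff_C_mul, coeff_X_pow, mul_ite, mul_one, mul_zero] at hc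
  rw [Finset.sum_filter]
  simp only [eq_comm (a := t)] at hc
  rw [hc, coeff_mul, Finset.Nat.sum_antidiagonal_eq_sum_range_succ_mk]
  refine Finset.sum_congr rfl fun s _ => ?_
  simp only
  rw [coeff_one_add_X_pow]
  congr 1
  have : (1 - X : ℂ[X]) ^ wtZ y = ((1 + X) ^ wtZ y).comp (C (-1) * X) := by
    simp [sub_eq_add_neg]
  rw [this, comp_C_mul_X_coeff, coeff_one_add_X_pow, mul_comm]


/-- Eigenvalue formula for the Clifford superoperators `Φ_t`: for `m = 2n` or
`m = 2n+1`, `0 ≤ t ≤ m` and `y ∈ F₂^m` with `j = wt(y)`,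
`(1/2^n) ∑_{wt(x) = t} Γ_x Γ_y Γ_x = W_t(j) Γ_y`; in particular every
`V_j^{Cl(m)} = span{Γ_y : wt(y) = j}` is an eigenspace of
`Φ_t(X) = (1/2^n) ∑_{wt(x)=t} Γ_x X Γ_x` with eigenvalue `W_t(j)`. -/
theorem clifford_Wtj_eigenvalues (n m : ℕ) (hn : 1 ≤ n)
    (hm : m = 2 * n ∨ m = 2 * n + 1) (t : ℕ) (ht : t ≤ m) :
    (∀ y : Fin m → ZMod 2,
      ((2 : ℂ) ^ n)⁻¹ •
          ∑ x ∈ Finset.filter (fun x : Fin m → ZMod 2 => wtZ x = t) Finset.univ,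
            gammaOp n m x * gammaOp n m y * gammaOp n m x =
        Wcl n m t (wtZ y) • gammaOp n m y) ∧
    (∀ j : ℕ, ∀ M ∈ Submodule.span ℂ
        {A | ∃ y : Fin m → ZMod 2, wtZ y = j ∧ A = gammaOp n m y},
      ((2 : ℂ) ^ n)⁻¹ •
          ∑ x ∈ Finset.filter (fun x : Fin m → ZMod 2 => wtZ x = t) Finset.univ,
            gammaOp n m x * M * gammaOp n m x =
        Wcl n m t j • M) := by
  have hm' : m ≤ 2 * n + 1 := by omega
  have main : ∀ y : Fin m → ZMod 2,
      ((2 : ℂ) ^ n)⁻¹ •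
          ∑ x ∈ Finset.filter (fun x : Fin m → ZMod 2 => wtZ x = t) Finset.univ,
            gammaOp n m x * gammaOp n m y * gammaOp n m x =
        Wcl n m t (wtZ y) • gammaOp n m y := by
    intro y
    simp only [gamma_conj n m hm']
    rw [← Finset.sum_smul, smul_smul, Wcl, ← kraw]
    congr 1
    rw [Finset.sum_congr rfl (g := fun x => (-1 : ℂ) ^ (t * wtZ y) * chi x y)
      (fun x hx => by rw [(Finset.mem_filter.mp hx).2]), ← Finset.mul_sum]
    ring
  refine ⟨main, fun j M hM => ?_⟩
  induction hM using Submodule.span_induction with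
  | mem M h =>
    obtain ⟨y, rfl, rfl⟩ := h
    exact main y
  | zero => simp
  | add a b _ _ ha hb =>
    simp only [mul_add, add_mul, Finset.sum_add_distrib, smul_add, ha, hb]
  | smul c a _ ha =>
    simp only [mul_smul_comm, smul_mul_assoc, ← Finset.smul_sum]
    rw [smul_comm, ha, smul_comm]

end
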